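/- arXiv:1708.04864 — 2 statements merged into one kernel-verified Lean document; each statement's English description precedes it below -/
import Mathlib

section
/- Let Σ be a finite alphabet with at least two letters and let I ⊆ Σ* be a nonempty ideal with ε ∉ I. Then there exists a strongly connected synchronizing automaton 𝓛 over Σ with Syn(𝓛) = I such that every strongly connected synchronizing automaton 𝒜 over Σ with Syn(𝒜) = I is a homomorphic image of 𝓛, i.e. there exists a surjective automaton homomorphism from 𝓛 onto 𝒜. -/
/-- The action of a word on a state: `actW δ q w` is `q · w`. -/
def actW {A Q : Type*} (δ : Q → A → Q) (q : Q) (w : List A) : Q := w.foldl δ q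

/-- The set of reset (synchronizing) words of the automaton `(Q, δ)`. -/
def SynSet {A Q : Type*} (δ : Q → A → Q) : Set (List A) :=
  {w | ∃ q : Q, ∀ p : Q, actW δ p w = q}

/-- `I` is a two-sided ideal of `Σ*`. -/
def IsIdealLang {A : Type*} (I : Set (List A)) : Prop :=
  ∀ x u y : List A, u ∈ I → x ++ u ++ y ∈ I

/-- The set of minimal words of an ideal: `𝓜(I) = I \ (Σ⁺I ∪ IΣ⁺)`. -/
def MinWords {A : Type*} (I : Set (List A)) : Set (List A) :=
  I \ ({w | ∃ x u : List A, x ≠ [] ∧ u ∈ I ∧ w = x ++ u} ∪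
       {w | ∃ u x : List A, u ∈ I ∧ x ≠ [] ∧ w = u ++ x})



open Classical in
/-- The shortest suffix of a word lying in `I`. -/
noncomputable def shortSuf {A : Type} (I : Set (List A)) : List A → List A
  | [] => []
  | a :: w => if w ∈ I then shortSuf I w else a :: w

section
variable {A : Type} {I : Set (List A)}

theorem ideal_left (hI : IsIdealLang I) (x : List A) {u : List A} (h : u ∈ I) : x ++ u ∈ I := by
  simpa using hI x u [] h

theorem ideal_right (hI : IsIdealLang I) {u : List A} (y : List A) (h : u ∈ I) : u ++ y ∈ I := by
  simpa using hI [] u y h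

theorem shortSuf_mem : ∀ {w : List A}, w ∈ I → shortSuf I w ∈ I
  | [], h => by simpa [shortSuf] using h
  | a :: w, h => by
    by_cases hw : w ∈ I
    · simpa [shortSuf, hw] using shortSuf_mem hw
    · simpa [shortSuf, hw] using h

theorem shortSuf_idem : ∀ (w : List A), shortSuf I (shortSuf I w) = shortSuf I w
  | [] => by simp [shortSuf]
  | a :: w => by
    by_cases hw : w ∈ I
    · simpa [shortSuf, hw] using shortSuf_idem w
    · simp [shortSuf, hw]

theorem shortSuf_left (hI : IsIdealLang I) {u : List A} (h : u ∈ I) :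
    ∀ x : List A, shortSuf I (x ++ u) = shortSuf I u
  | [] => rfl
  | a :: x => by
    have := ideal_left hI x h
    simpa [shortSuf, this] using shortSuf_left hI h x

theorem shortSuf_append (hI : IsIdealLang I) (y : List A) :
    ∀ w : List A, shortSuf I (shortSuf I w ++ y) = shortSuf I (w ++ y)
  | [] => by simp [shortSuf]
  | a :: w => by
    by_cases hw : w ∈ I
    · have := ideal_right hI y hw
      simpa [shortSuf, hw, this] using shortSuf_append hI y w
    · simp [shortSuf, hw]

theorem shortSuf_suffix {w : List A} (hw : w ∉ I) (a : A) :
    ∀ u : List A, (a :: w) <:+ shortSuf I (u ++ a :: w)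
  | [] => by simp [shortSuf, hw]
  | c :: u => by
    by_cases h : u ++ a :: w ∈ I
    · simpa [shortSuf, h] using shortSuf_suffix hw a u
    · simp only [List.cons_append, shortSuf, h, if_false]
      exact (List.suffix_append u _).trans (List.suffix_cons _ _)

theorem actW_append {Q : Type} (δ : Q → A → Q) (q : Q) (u v : List A) :
    actW δ q (u ++ v) = actW δ (actW δ q u) v := by simp [actW]

theorem actW_shortSuf {Q : Type} (δ : Q → A → Q) (h : SynSet δ = I) (q : Q) :
    ∀ w : List A, actW δ q (shortSuf I w) = actW δ q w
  | [] => rfl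
  | a :: w => by
    by_cases hw : w ∈ I
    · have h1 : actW δ q (shortSuf I (a :: w)) = actW δ q w := by
        simpa [shortSuf, hw] using actW_shortSuf δ h q w
      rw [h1]
      rw [← h] at hw
      obtain ⟨r, hr⟩ := hw
      rw [hr q]
      exact (hr (δ q a)).symm
    · simp [shortSuf, hw]

/-- States of the maximal lifted automaton. -/
def LState (I : Set (List A)) : Type := {w : List A // w ∈ I ∧ shortSuf I w = w}

/-- The state reached by a word of the ideal. -/
noncomputable def LState.of {w : List A} (h : w ∈ I) : LState I :=
  ⟨shortSuf I w, shortSuf_mem h, shortSuf_idem w⟩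

/-- Transition function. -/
noncomputable def LState.step (hI : IsIdealLang I) (p : LState I) (a : A) : LState I :=
  LState.of (ideal_right hI [a] p.2.1)

theorem LState.act (hI : IsIdealLang I) :
    ∀ (w : List A) (p : LState I), (actW (LState.step hI) p w).1 = shortSuf I (p.1 ++ w)
  | [], p => by simpa [actW] using p.2.2.symm
  | a :: w, p => by
    have := LState.act hI w (LState.step hI p a)
    refine this.trans ?_
    change shortSuf I (shortSuf I (p.1 ++ [a]) ++ w) = _
    rw [shortSuf_append hI]
    simp

end

/-- existence of the maximal lifted strongly connected automaton: a
strongly connected synchronizing automaton `𝓛` with `Syn(𝓛) = I` of which every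
strongly connected synchronizing automaton with set of reset words `I` is a
homomorphic image. -/
theorem stmt15 {A : Type} [Fintype A] (hA : 1 < Fintype.card A)
    (I : Set (List A)) (hI : IsIdealLang I) (hne : I.Nonempty)
    (hε : ([] : List A) ∉ I) :
    ∃ (L : Type) (_ : Nonempty L) (ξ : L → A → L),
      (∀ p q : L, ∃ w : List A, actW ξ p w = q) ∧ SynSet ξ = I ∧
      ∀ (Q : Type) (_ : Nonempty Q) (δ : Q → A → Q),
        (∀ p q : Q, ∃ w : List A, actW δ p w = q) → SynSet δ = I →
        ∃ φ : L → Q, Function.Surjective φ ∧ ∀ (l : L) (a : A), φ (ξ l a) = δ (φ l) a := by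
  obtain ⟨u, hu⟩ := hne
  refine ⟨LState I, ⟨LState.of hu⟩, LState.step hI, ?_, ?_, ?_⟩
  · intro p q
    refine ⟨q.1, Subtype.ext ?_⟩
    rw [LState.act, shortSuf_left hI q.2.1, q.2.2]
  · ext w
    constructor
    · rintro ⟨q, hq⟩
      by_contra hw
      obtain ⟨a, b, hab⟩ := Fintype.one_lt_card_iff.mp hA
      have key : ∀ c : A, (c :: w) <:+ q.1 := by
        intro c
        have h1 := congrArg Subtype.val (hq (LState.of (ideal_right hI [c] hu)))
        rw [LState.act] at h1
        change shortSuf I (shortSuf I (u ++ [c]) ++ w) = _ at h1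
        rw [shortSuf_append hI] at h1
        rw [← h1]
        simpa using shortSuf_suffix hw c u
      have h2 : (a :: w) <:+ (b :: w) :=
        List.suffix_of_suffix_length_le (key a) (key b) (by simp)
      have h3 := h2.eq_of_length (by simp)
      exact hab (List.cons.inj h3).1
    · intro hw
      refine ⟨LState.of hw, fun p => Subtype.ext ?_⟩
      rw [LState.act, shortSuf_left hI hw]
      rfl
  · intro Q hQ δ hsc hsyn
    obtain ⟨q0⟩ := hQ
    refine ⟨fun l => actW δ q0 l.1, ?_, ?_⟩
    · intro q
      obtain ⟨v, hv⟩ := hsc (actW δ q0 u) q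
      refine ⟨LState.of (ideal_right hI v hu), ?_⟩
      change actW δ q0 (shortSuf I (u ++ v)) = q
      rw [actW_shortSuf δ hsyn, actW_append, hv]
    · intro l a
      change actW δ q0 (shortSuf I (l.1 ++ [a])) = _
      rw [actW_shortSuf δ hsyn, actW_append]
      rfl
end

section
/- Let Σ be a finite alphabet with k ≥ 2 letters and let I ⊆ Σ* be a nonempty regular ideal with ε ∉ I. Let m = ‖I‖ and let n be the (finite) number of distinct nonempty left quotients u⁻¹𝓜(I) as u ranges over Σ* (the number of states of the minimal partial DFA recognizing 𝓜(I)). Then there exists a strongly connected synchronizing automaton 𝒜 over Σ with a finite state set of cardinality at most k·m^k·2^{k·m^k·n} such that Syn(𝒜) = I. -/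
/-- `‖I‖`, the minimal length of a word of `I`. -/
noncomputable def normL {A : Type*} (I : Set (List A)) : ℕ :=
  sInf {k | ∃ u ∈ I, u.length = k}

/-- The left quotient `s⁻¹L = {w : s·w ∈ L}`. -/
def lquot {A : Type*} (L : Set (List A)) (s : List A) : Set (List A) := {w | s ++ w ∈ L}

open Classical in
/-- Shortest suffix lying in `I` (if `w ∈ I`). -/
noncomputable def sfx {A : Type} (I : Set (List A)) : List A → List A
  | [] => []
  | a :: w => if w ∈ I then sfx I w else a :: w

theorem suffix_append_cases {A : Type} {y z x : List A} (h : y <:+ z ++ x) :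
    y <:+ x ∨ ∃ z', z' <:+ z ∧ y = z' ++ x := by
  obtain ⟨r, hr⟩ := h
  rcases List.append_eq_append_iff.1 hr with ⟨c, h1, h2⟩ | ⟨c, h1, h2⟩
  · exact Or.inr ⟨c, ⟨r, h1.symm⟩, h2⟩
  · exact Or.inl ⟨c, h2.symm⟩

section
variable {A : Type} {I : Set (List A)}

theorem ideal_suffix (hI : IsIdealLang I) {x w : List A} (h : x <:+ w) (hx : x ∈ I) : w ∈ I := by
  obtain ⟨r, rfl⟩ := h
  simpa using hI r x [] hx

theorem ideal_prefix (hI : IsIdealLang I) {x y : List A} (hx : x ∈ I) : x ++ y ∈ I := by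
  simpa using hI [] x y hx

theorem sfx_mem (w : List A) (hw : w ∈ I) : sfx I w ∈ I := by
  induction w with
  | nil => simpa [sfx] using hw
  | cons a w ih =>
    rw [sfx]
    split_ifs with h
    · exact ih h
    · exact hw

theorem sfx_suffix (w : List A) : sfx I w <:+ w := by
  induction w with
  | nil => simp [sfx]
  | cons a w ih =>
    rw [sfx]
    split_ifs with h
    · exact ih.trans (List.suffix_cons a w)
    · exact List.suffix_rfl

theorem sfx_append (hI : IsIdealLang I) (x w : List A) (hw : w ∈ I) :
    sfx I (x ++ w) = sfx I w := by
  induction x with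
  | nil => rfl
  | cons a x ih =>
    rw [List.cons_append, sfx, if_pos, ih]
    exact ideal_suffix hI (List.suffix_append x w) hw

/-- if no proper suffix in `I`, `sfx` is the identity. -/
theorem sfx_eq_self (w : List A) (h : ∀ x y, x ≠ [] → w = x ++ y → y ∉ I) : sfx I w = w := by
  cases w with
  | nil => rfl
  | cons a w =>
    rw [sfx, if_neg]
    exact h [a] w (by simp) rfl

theorem sfx_proper (hI : IsIdealLang I) (hε : ([] : List A) ∉ I) (w : List A) (hw : w ∈ I)
    (x y : List A) (hx : x ≠ []) (h : sfx I w = x ++ y) : y ∉ I := by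
  intro hy
  obtain ⟨r, hr⟩ := sfx_suffix (I := I) w
  have h1 : sfx I w = sfx I y := by
    rw [← sfx_append hI (r ++ x) y hy, List.append_assoc, ← h, hr]
  have h2 := (sfx_suffix (I := I) y).length_le
  rw [← h1, h] at h2
  have := List.length_pos_iff.2 hx
  simp at h2
  exact hx h2

theorem sfx_minWord {w : List A} (hw : w ∈ MinWords I) : sfx I w = w := by
  apply sfx_eq_self
  intro x y hx he hy
  exact hw.2 (Or.inl ⟨x, y, hx, hy, he⟩)

theorem sfx_snoc_of_token (hI : IsIdealLang I) {w x : List A} {a : A} (hx : x <:+ w)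
    (hm : x ++ [a] ∈ MinWords I) : sfx I (w ++ [a]) = x ++ [a] := by
  obtain ⟨r, rfl⟩ := hx
  rw [List.append_assoc, sfx_append hI _ _ hm.1, sfx_minWord hm]

theorem sfx_snoc_of_not_token (hI : IsIdealLang I) (hε : ([] : List A) ∉ I) {w : List A} {a : A}
    (hw : w ∈ I) (hno : ¬ ∃ x, x <:+ w ∧ x ++ [a] ∈ MinWords I) :
    sfx I (w ++ [a]) = sfx I w ++ [a] := by
  have hsI := sfx_mem w hw
  have hs := sfx_suffix (I := I) w
  have hwa : w ++ [a] ∈ I := ideal_prefix hI hw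
  have e1 : sfx I (w ++ [a]) = sfx I (sfx I w ++ [a]) := by
    obtain ⟨r, hr⟩ := hs
    conv_lhs => rw [← hr, List.append_assoc]
    exact sfx_append hI _ _ (ideal_prefix hI hsI)
  have hmem := sfx_mem _ hwa
  have hsuf : sfx I (w ++ [a]) <:+ sfx I w ++ [a] := by
    rw [e1]; exact sfx_suffix _
  rcases suffix_append_cases hsuf with h | ⟨y, hy, he⟩
  · exfalso
    have hle : [a] ∈ I := ideal_suffix hI h hmem
    apply hno
    refine ⟨[], List.nil_suffix, ?_⟩
    refine ⟨hle, ?_⟩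
    rintro (⟨x, v, hx, hv, hxv⟩ | ⟨v, x, hv, hx, hxv⟩)
    · have : v = [] := by
        cases x with
        | nil => exact absurd rfl hx
        | cons b x => simp at hxv; exact hxv.2.2
      exact hε (this ▸ hv)
    · have : v = [] := by
        cases v with
        | nil => rfl
        | cons b v => simp at hxv; exact absurd hxv.2.2 hx
      exact hε (this ▸ hv)
  · by_cases hyI : y ∈ I
    · obtain ⟨r, hr⟩ := hy
      by_cases hr0 : r = []
      · subst hr0
        rw [he, ← hr]; rfl
      · exact absurd hyI (sfx_proper hI hε w hw r y hr0 hr.symm)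
    · exfalso
      apply hno
      refine ⟨y, hy.trans hs, he ▸ hmem, ?_⟩
      rintro (⟨x, v, hx, hv, hxv⟩ | ⟨v, x, hv, hx, hxv⟩)
      · exact sfx_proper hI hε _ hwa x v hx (he.trans hxv) hv
      · apply hyI
        have hp : v <+: y := by
          rcases List.eq_nil_or_concat x with h | ⟨x', b, h⟩
          · exact absurd h hx
          · subst h
            rw [List.concat_eq_append, ← List.append_assoc] at hxv
            exact ⟨x', (List.append_inj_left' hxv rfl).symm⟩
        obtain ⟨t, rfl⟩ := hp
        exact ideal_prefix hI hv

end

section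
variable {A : Type} {G : Type} [AddCommMonoid G]

/-- The set of tokens. -/
def tok (I : Set (List A)) (g : List A → G) (w : List A) : Set (G × Set (List A)) :=
  {t | ∃ x, x <:+ w ∧ (lquot (MinWords I) x).Nonempty ∧ t = (g x, lquot (MinWords I) x)}

/-- The state reached. -/
noncomputable def stateOf (I : Set (List A)) (g : List A → G) (w : List A) :
    G × Set (G × Set (List A)) := (g (sfx I w), tok I g w)

theorem lquot_snoc {I : Set (List A)} (x : List A) (a : A) :
    lquot I (x ++ [a]) = {t | a :: t ∈ lquot I x} := by
  ext t; simp [lquot]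

theorem tok_snoc_sub {I : Set (List A)} {g : List A → G} (hg : ∀ x y, g (x ++ y) = g x + g y)
    {w w' : List A} (h : tok I g w = tok I g w') (a : A) :
    tok I g (w ++ [a]) ⊆ tok I g (w' ++ [a]) := by
  rintro t ⟨x, hx, hne, rfl⟩
  rcases List.eq_nil_or_concat x with h0 | ⟨y, b, h0⟩
  · subst h0
    exact ⟨[], List.nil_suffix, hne, rfl⟩
  · rw [List.concat_eq_append] at h0
    subst h0
    obtain ⟨r, hr⟩ := hx
    rw [← List.append_assoc] at hr
    obtain ⟨h1, h2⟩ := List.append_inj' hr rfl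
    simp only [List.cons.injEq, and_true] at h2
    subst h2
    have hy : (g y, lquot (MinWords I) y) ∈ tok I g w := by
      refine ⟨y, ⟨r, h1⟩, ?_, rfl⟩
      obtain ⟨t, ht⟩ := hne
      rw [lquot_snoc] at ht
      exact ⟨_, ht⟩
    rw [h] at hy
    obtain ⟨y', ⟨r', hy'⟩, hne', he⟩ := hy
    simp only [Prod.mk.injEq] at he
    refine ⟨y' ++ [b], ⟨r', by rw [← hy', List.append_assoc]⟩, ?_, ?_⟩
    · rw [lquot_snoc, ← he.2, ← lquot_snoc]; exact hne
    · rw [hg, hg, he.1, lquot_snoc, lquot_snoc, he.2]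

theorem stateOf_snoc {I : Set (List A)} (hI : IsIdealLang I) (hε : ([] : List A) ∉ I)
    {g : List A → G} (hg : ∀ x y, g (x ++ y) = g x + g y)
    {w w' : List A} (hw : w ∈ I) (hw' : w' ∈ I) (h : stateOf I g w = stateOf I g w') (a : A) :
    stateOf I g (w ++ [a]) = stateOf I g (w' ++ [a]) := by
  simp only [stateOf, Prod.mk.injEq] at h ⊢
  obtain ⟨h1, h2⟩ := h
  refine ⟨?_, (tok_snoc_sub hg h2 a).antisymm (tok_snoc_sub hg h2.symm a)⟩
  have key : ∀ {v v' : List A}, tok I g v = tok I g v' →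
      ∀ x, x <:+ v → x ++ [a] ∈ MinWords I →
        ∃ x', x' <:+ v' ∧ x' ++ [a] ∈ MinWords I ∧ g x = g x' := by
    intro v v' hv x hx hm
    have : (g x, lquot (MinWords I) x) ∈ tok I g v := ⟨x, hx, ⟨[a], hm⟩, rfl⟩
    rw [hv] at this
    obtain ⟨x', hx', hne, he⟩ := this
    simp only [Prod.mk.injEq] at he
    refine ⟨x', hx', ?_, he.1⟩
    have : [a] ∈ lquot (MinWords I) x := hm
    rw [he.2] at this
    exact this
  by_cases hT : ∃ x, x <:+ w ∧ x ++ [a] ∈ MinWords I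
  · obtain ⟨x, hx, hm⟩ := hT
    obtain ⟨x', hx', hm', he⟩ := key h2 x hx hm
    rw [sfx_snoc_of_token hI hx hm, sfx_snoc_of_token hI hx' hm', hg, hg, he]
  · have hT' : ¬ ∃ x, x <:+ w' ∧ x ++ [a] ∈ MinWords I := by
      rintro ⟨x, hx, hm⟩
      obtain ⟨x', hx', hm', _⟩ := key h2.symm x hx hm
      exact hT ⟨x', hx', hm'⟩
    rw [sfx_snoc_of_not_token hI hε hw hT, sfx_snoc_of_not_token hI hε hw' hT', hg, hg, h1]

theorem stateOf_append {I : Set (List A)} (hI : IsIdealLang I)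
    {g : List A → G} (x w : List A) (hw : w ∈ I) : stateOf I g (x ++ w) = stateOf I g w := by
  simp only [stateOf, Prod.mk.injEq]
  refine ⟨by rw [sfx_append hI x w hw], ?_⟩
  ext t
  constructor
  · rintro ⟨y, hy, hne, rfl⟩
    rcases suffix_append_cases hy with h | ⟨r, hr, rfl⟩
    · exact ⟨y, h, hne, rfl⟩
    · have hr0 : r = [] := by
        by_contra hr0
        obtain ⟨t, ht⟩ := hne
        exact ht.2 (Or.inl ⟨r, w ++ t, hr0, ideal_prefix hI hw, by simp⟩)
      subst hr0
      exact ⟨_, List.suffix_rfl, hne, rfl⟩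
  · rintro ⟨y, hy, hne, rfl⟩
    exact ⟨y, hy.trans (List.suffix_append x w), hne, rfl⟩

end

/-- The combinatorial core. -/
theorem comb_core {A : Type} [DecidableEq A] (V : Set (List A)) (z : List A) (m : ℕ)
    (hz : z.length = m) (p q : A) (hpq : p ≠ q) (z0 : List A) (hlast : z = z0 ++ [p])
    (N : A → ℕ) (hN : ∀ c, N c = if c = q then 2 * m else m)
    (h1 : ∀ x, ∃ v ∈ V, v <:+ z ++ x)
    (h2 : ∀ v ∈ V, ∀ w ∈ V, v <:+ w → v = w) (h3 : [] ∉ V)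
    (h4 : ∀ v ∈ V, ∀ w ∈ V, ∀ c, v.count c ≡ w.count c [MOD N c]) : False := by
  have hm : 1 ≤ m := by rw [← hz, hlast]; simp
  obtain ⟨v, hv, hvz⟩ := h1 []
  rw [List.append_nil] at hvz
  have hpsuf : ∀ y, y <:+ z → y ≠ [] → 1 ≤ y.count p := by
    intro y hy hne
    rw [hlast] at hy
    rcases suffix_append_cases hy with h | ⟨y', -, rfl⟩
    · have := h.length_le
      have h0 := List.length_pos_iff.2 hne
      have := h.eq_of_length (by simp at *; omega)
      subst this; simp
    · simp
  have hcnt : ∀ y : List A, y.count p + y.count q ≤ y.length := by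
    intro y
    induction y with
    | nil => simp
    | cons b y ih =>
      simp only [List.count_cons, List.length_cons, beq_iff_eq]
      by_cases hb : b = p
      · subst hb; simp [hpq]; omega
      · simp [hb]; split_ifs <;> omega
  cases v with
  | nil => exact h3 hv
  | cons a t =>
  have hnot : ∀ w ∈ V, ¬ w <:+ t := by
    intro w hw h
    have := h2 w hw _ hv (h.trans (List.suffix_cons a t))
    subst this
    have := h.length_le
    simp at this
  have hNq : N q = 2 * m := by simp [hN]
  have hNp : N p = m := by simp [hN, hpq]
  by_cases haq : a = q
  · subst haq
    obtain ⟨w, hw, hws⟩ := h1 (List.replicate m p ++ t)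
    rw [← List.append_assoc] at hws
    rcases suffix_append_cases hws with h | ⟨y, hy, rfl⟩
    · exact hnot w hw h
    have hq := h4 _ hw _ hv a
    have hp := h4 _ hw _ hv p
    rw [List.count_append, List.count_cons_self, hNq, Nat.add_comm (t.count a) 1] at hq
    rw [List.count_append, List.count_cons_of_ne hpq.symm, hNp] at hp
    have hq' := Nat.ModEq.add_right_cancel' _ hq
    have hp' : y.count p ≡ 0 [MOD m] := by
      apply Nat.ModEq.add_right_cancel' (t.count p)
      simpa using hp
    rcases suffix_append_cases hy with h | ⟨z', hz', rfl⟩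
    · have h0 : y.count a = 0 := by
        have := h.sublist.count_le a
        rw [List.count_replicate] at this
        simpa [hpq] using this
      rw [h0] at hq'
      have := (Nat.modEq_iff_dvd' (by omega)).1 hq'
      have := Nat.le_of_dvd (by omega) this
      omega
    · rw [List.count_append, List.count_replicate_self] at hp'
      rw [List.count_append, List.count_replicate] at hq'
      simp only [beq_iff_eq, hpq, if_false, Nat.add_zero] at hq'
      have hlen := hz'.length_le
      have hc := hcnt z'
      have hq0 : z'.count a ≠ 0 := by
        intro h0
        rw [h0] at hq'
        have := (Nat.modEq_iff_dvd' (by omega)).1 hq'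
        have := Nat.le_of_dvd (by omega) this
        omega
      have hne : z' ≠ [] := by
        rintro rfl
        simp at hq0
      have hp1 := hpsuf z' hz' hne
      have hd := (Nat.modEq_zero_iff_dvd).1 hp'
      have hd' : m ∣ z'.count p := (Nat.dvd_add_left (dvd_refl m)).1 hd
      have := Nat.le_of_dvd (by omega) hd'
      omega
  · obtain ⟨w, hw, hws⟩ := h1 ([q] ++ t)
    rw [← List.append_assoc] at hws
    rcases suffix_append_cases hws with h | ⟨y, hy, rfl⟩
    · exact hnot w hw h
    have hy0 : y ≠ [] := by
      rintro rfl
      exact hnot _ hw (by simp)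
    have hq := h4 _ hw _ hv q
    rw [List.count_append, List.count_cons_of_ne haq, hNq] at hq
    have hq' : y.count q ≡ 0 [MOD 2 * m] := by
      apply Nat.ModEq.add_right_cancel' (t.count q)
      simpa using hq
    have hd := (Nat.modEq_zero_iff_dvd).1 hq'
    rcases suffix_append_cases hy with h | ⟨z', hz', rfl⟩
    · have := h.length_le
      have h0 := List.length_pos_iff.2 hy0
      have := h.eq_of_length (by simp at *; omega)
      subst this
      simp at hd
    · rw [List.count_append, List.count_singleton_self] at hd
      have := Nat.le_of_dvd (by omega) hd
      have hlen := hz'.length_le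
      have hc := hcnt z'
      have hne : z' ≠ [] := by
        rintro rfl
        simp at this
        omega
      have := hpsuf z' hz' hne
      omega

/-- for a regular ideal `I` (`ε ∉ I`) over an alphabet with `k ≥ 2`
letters, with `m = ‖I‖` and `n` the number of distinct nonempty left quotients of
`𝓜(I)`, there is a strongly connected synchronizing automaton with at most
`k·m^k·2^(k·m^k·n)` states whose set of reset words is `I`. -/
theorem stmt19 {A : Type} [Fintype A]
    (I : Set (List A)) (hI : IsIdealLang I) (hne : I.Nonempty)
    (hε : ([] : List A) ∉ I)
    (hreg : {L : Set (List A) | ∃ u : List A, L = lquot I u}.Finite)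
    (k m n : ℕ) (hk : k = Fintype.card A) (hk2 : 2 ≤ k) (hm : m = normL I)
    (hfin : {D : Set (List A) | D.Nonempty ∧ ∃ u : List A,
        D = lquot (MinWords I) u}.Finite)
    (hn : {D : Set (List A) | D.Nonempty ∧ ∃ u : List A,
        D = lquot (MinWords I) u}.ncard = n) :
    ∃ (Q : Type) (inst : Fintype Q) (_ : Nonempty Q) (δ : Q → A → Q),
      @Fintype.card Q inst ≤ k * m ^ k * 2 ^ (k * m ^ k * n) ∧
      (∀ p q : Q, ∃ w : List A, actW δ p w = q) ∧ SynSet δ = I := by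
  classical
  have hSne : {k | ∃ u ∈ I, u.length = k}.Nonempty := by
    obtain ⟨u, hu⟩ := hne
    exact ⟨_, u, hu, rfl⟩
  obtain ⟨z, hzI, hzl⟩ := Nat.sInf_mem hSne
  have hzm : z.length = m := by rw [hm]; exact hzl
  have hz0 : z ≠ [] := by rintro rfl; exact hε hzI
  obtain ⟨z0, p, hlast⟩ := (List.eq_nil_or_concat z).resolve_left hz0
  rw [List.concat_eq_append] at hlast
  have hm1 : 1 ≤ m := by rw [← hzm, hlast]; simp
  have : Nontrivial A := Fintype.one_lt_card_iff_nontrivial.1 (by omega)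
  obtain ⟨q, hqp⟩ := exists_ne p
  let N : A → ℕ := fun c => if c = q then 2 * m else m
  have hNz : ∀ c, NeZero (N c) := fun c => ⟨by simp only [N]; split_ifs <;> omega⟩
  let g : List A → (∀ c, ZMod (N c)) := fun w c => (w.count c : ZMod (N c))
  have hg : ∀ x y, g (x ++ y) = g x + g y := by
    intro x y; funext c; simp [g]
  have hcardG : Fintype.card (∀ c, ZMod (N c)) ≤ k * m ^ k := by
    rw [Fintype.card_pi]
    simp only [ZMod.card]
    have : ∏ c, N c = 2 * m ^ k := by
      have e : ∀ c, N c = (if c = q then 2 else 1) * m := by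
        intro c; simp only [N]; split_ifs <;> simp
      simp only [e, Finset.prod_mul_distrib, Finset.prod_const, Finset.card_univ, ← hk]
      simp
    rw [this]
    exact Nat.mul_le_mul_right _ hk2
  generalize hDD : {D : Set (List A) | D.Nonempty ∧ ∃ u : List A,
        D = lquot (MinWords I) u} = DD at hfin hn
  let f := stateOf I g
  let G := ∀ c, ZMod (N c)
  let X : Set (G × Set (G × Set (List A))) :=
    Set.univ ×ˢ (𝒫 (Set.univ ×ˢ DD))
  have hYfin : (Set.univ ×ˢ DD : Set (G × Set (List A))).Finite := Set.finite_univ.prod hfin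
  have hXfin : X.Finite := Set.finite_univ.prod hYfin.finite_subsets
  have hXcard : X.ncard ≤ k * m ^ k * 2 ^ (k * m ^ k * n) := by
    simp only [X]
    rw [Set.ncard_prod, Set.ncard_powerset _ hYfin, Set.ncard_prod, hn, Set.ncard_univ,
      Nat.card_eq_fintype_card]
    exact Nat.mul_le_mul hcardG
      (Nat.pow_le_pow_right (by norm_num) (Nat.mul_le_mul_right _ hcardG))
  have hsub : f '' I ⊆ X := by
    rintro _ ⟨w, hw, rfl⟩
    refine ⟨trivial, ?_⟩
    rintro t ⟨x, hx, hne, rfl⟩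
    refine ⟨trivial, ?_⟩
    rw [← hDD]
    exact ⟨hne, x, rfl⟩
  have hQfin : (f '' I).Finite := hXfin.subset hsub
  let Q := ↥(f '' I)
  let st : ∀ w, w ∈ I → Q := fun w hw => ⟨f w, w, hw, rfl⟩
  have hst : ∀ s : Q, ∃ w, ∃ hw : w ∈ I, s = st w hw := by
    rintro ⟨_, w, hw, rfl⟩
    exact ⟨w, hw, rfl⟩
  choose rep hrepI hrep using hst
  let δ : Q → A → Q := fun s a => st (rep s ++ [a]) (ideal_prefix hI (hrepI s))
  have hδ : ∀ w (hw : w ∈ I) a, δ (st w hw) a = st (w ++ [a]) (ideal_prefix hI hw) := by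
    intro w hw a
    apply Subtype.ext
    exact stateOf_snoc hI hε hg (hrepI _) hw (congrArg Subtype.val (hrep (st w hw))).symm a
  have hact : ∀ u w (hw : w ∈ I), actW δ (st w hw) u = st (w ++ u) (ideal_prefix hI hw) := by
    intro u
    induction u with
    | nil => intro w hw; apply Subtype.ext; simp [actW, st]
    | cons a u ih =>
      intro w hw
      have : actW δ (st w hw) (a :: u) = actW δ (δ (st w hw) a) u := rfl
      rw [this, hδ w hw, ih _ (ideal_prefix hI hw)]
      apply Subtype.ext
      simp [st]
  refine ⟨Q, hQfin.fintype, ⟨st z hzI⟩, δ, ?_, ?_, ?_⟩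
  · have h1 : (f '' I).ncard ≤ X.ncard := Set.ncard_le_ncard hsub hXfin
    refine le_trans (le_of_eq ?_) (h1.trans hXcard)
    rw [← Nat.card_coe_set_eq]
    exact (@Nat.card_eq_fintype_card Q hQfin.fintype).symm
  · intro s s'
    refine ⟨rep s', ?_⟩
    rw [hrep s, hact _ _ (hrepI s)]
    conv_rhs => rw [hrep s']
    exact Subtype.ext (stateOf_append hI _ _ (hrepI s'))
  · ext u
    constructor
    · rintro ⟨s, hs⟩
      by_contra hu
      have hconst : ∀ w ∈ I, ∀ w' ∈ I, g (sfx I (w ++ u)) = g (sfx I (w' ++ u)) := by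
        intro w hw w' hw'
        have h := (hs (st w hw)).trans (hs (st w' hw')).symm
        rw [hact _ _ hw, hact _ _ hw'] at h
        exact congrArg Prod.fst (congrArg Subtype.val h)
      refine comb_core {v | v ++ u ∈ I ∧ sfx I (v ++ u) = v ++ u} z m hzm p q hqp.symm z0 hlast N
        (fun c => rfl) ?_ ?_ ?_ ?_
      · intro x
        have hzx : z ++ x ++ u ∈ I := ideal_prefix hI (ideal_prefix hI hzI)
        have hs1 := sfx_mem _ hzx
        rcases suffix_append_cases (sfx_suffix (I := I) (z ++ x ++ u)) with h | ⟨v, hv, he⟩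
        · exact absurd (ideal_suffix hI h hs1) hu
        · have hvu : v ++ u ∈ I := he ▸ hs1
          refine ⟨v, ⟨hvu, ?_⟩, hv⟩
          obtain ⟨r, hr⟩ := hv
          rw [← hr, List.append_assoc, sfx_append hI r (v ++ u) hvu] at he
          exact he
      · rintro v ⟨hv, hv'⟩ w ⟨hw, hw'⟩ ⟨r, rfl⟩
        rw [List.append_assoc, sfx_append hI _ _ hv, hv'] at hw'
        have := congrArg List.length hw'
        simp at this
        subst this
        rfl
      · rintro ⟨h, -⟩
        exact hu h
      · rintro v ⟨hv, hv'⟩ w ⟨hw, hw'⟩ c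
        have h := hconst (z ++ v) (ideal_prefix hI hzI) (z ++ w) (ideal_prefix hI hzI)
        rw [List.append_assoc, List.append_assoc, sfx_append hI _ _ hv, sfx_append hI _ _ hw,
          hv', hw', hg, hg] at h
        have h' := congrFun (add_right_cancel h) c
        exact (ZMod.natCast_eq_natCast_iff _ _ _).1 h'
    · intro hu
      refine ⟨st u hu, ?_⟩
      intro s
      rw [hrep s, hact _ _ (hrepI s)]
      exact Subtype.ext (stateOf_append hI _ _ hu)
end
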